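/- Concavification-like characterization of optimal ambiguous persuasion: The value of the sender's problem (P), namely the supremum of U_s(σ, μ, τ*) over obedient ambiguous experiments (σ, μ), equals u if, and only if, the value of the program (Φ*(u)) — the supremum of Σ_θ λ_θ Φ_u(σ_θ) over finite families (λ_θ, σ_θ) with λ_θ ≥ 0, Σ_θ λ_θ = 1, each σ_θ an experiment, and Σ_θ λ_θ σ_θ obedient — equals 0, where Φ_u(σ) := (φ_s(u_s(σ,τ*)) − φ_s(u)) / φ_r'(u_r(σ,τ*)). Moreover, there exists a solution (σ*, μ*) to (P) whose support has at most |Ω|·(|A|−1) + 1 elements. -/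

import Mathlib

open Finset

/-- A stochastic kernel from `X` to `Y`: each row `k x` is a probability vector on `Y`.
An experiment is a kernel from states `Ω` to messages; a receiver strategy is a kernel
from messages to actions `A`. -/
def IsKernel {X Y : Type*} [Fintype Y] (k : X → Y → ℝ) : Prop :=
  (∀ x y, 0 ≤ k x y) ∧ ∀ x, ∑ y, k x y = 1

/-- A probability vector on a finite type. -/
def IsProb {Θ : Type*} [Fintype Θ] (μ : Θ → ℝ) : Prop :=
  (∀ θ, 0 ≤ μ θ) ∧ ∑ θ, μ θ = 1

/-- The obedient strategy `τ*`: take the recommended action with probability one. -/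
noncomputable def tauStar {A : Type*} [DecidableEq A] : A → A → ℝ :=
  fun m a => if a = m then (1 : ℝ) else 0

/-- Expected payoff `u_i(σ, τ) = ∑_{ω,m,a} p(ω) σ(m|ω) τ(a|m) u_i(a,ω)`. -/
noncomputable def expPayoff {Ω M A : Type*} [Fintype Ω] [Fintype M] [Fintype A]
    (p : Ω → ℝ) (u : A → Ω → ℝ) (σ : Ω → M → ℝ) (τ : M → A → ℝ) : ℝ :=
  ∑ ω, ∑ m, ∑ a, p ω * σ ω m * τ m a * u a ω

/-- Obedience of a single (unambiguous) canonical experiment: `τ*` is a best reply. -/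
def Obedient {Ω A : Type*} [Fintype Ω] [Fintype A] [DecidableEq A]
    (p : Ω → ℝ) (ur : A → Ω → ℝ) (σ : Ω → A → ℝ) : Prop :=
  ∀ τ : A → A → ℝ, IsKernel τ → expPayoff p ur σ τ ≤ expPayoff p ur σ tauStar

/-- Obedience of an ambiguous experiment `(σ, μ)` for a smooth-ambiguity receiver with
index `φr`:  `τ*` maximizes `τ ↦ U_r(σ, μ, τ) = φr⁻¹(∑_θ μ_θ φr(u_r(σ_θ, τ)))`; since `φr`
is strictly increasing this is equivalent to `τ*` maximizing `τ ↦ ∑_θ μ_θ φr(u_r(σ_θ, τ))`. -/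
def AmbObedient {Ω A Θ : Type*} [Fintype Ω] [Fintype A] [DecidableEq A] [Fintype Θ]
    (φr : ℝ → ℝ) (p : Ω → ℝ) (ur : A → Ω → ℝ) (σ : Θ → Ω → A → ℝ) (μ : Θ → ℝ) : Prop :=
  ∀ τ : A → A → ℝ, IsKernel τ →
    ∑ θ, μ θ * φr (expPayoff p ur (σ θ) τ) ≤ ∑ θ, μ θ * φr (expPayoff p ur (σ θ) tauStar)

/-- A smooth ambiguity index: strictly increasing, concave, differentiable. -/
def SmoothIndex (φ : ℝ → ℝ) : Prop :=
  StrictMono φ ∧ ConcaveOn ℝ Set.univ φ ∧ Differentiable ℝ φ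

/-- Two experiments are (strictly) Pareto ranked: under obedience, sender and receiver
strictly rank them the same way. -/
def ParetoRanked {Ω A : Type*} [Fintype Ω] [Fintype A] [DecidableEq A]
    (p : Ω → ℝ) (us ur : A → Ω → ℝ) (σ σ' : Ω → A → ℝ) : Prop :=
  (expPayoff p us σ' tauStar < expPayoff p us σ tauStar ∧
      expPayoff p ur σ' tauStar < expPayoff p ur σ tauStar) ∨
  (expPayoff p us σ tauStar < expPayoff p us σ' tauStar ∧
      expPayoff p ur σ tauStar < expPayoff p ur σ' tauStar)

/-- Two experiments are weakly Pareto ranked. -/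
def WeaklyParetoRanked {Ω A : Type*} [Fintype Ω] [Fintype A] [DecidableEq A]
    (p : Ω → ℝ) (us ur : A → Ω → ℝ) (σ σ' : Ω → A → ℝ) : Prop :=
  (expPayoff p us σ' tauStar ≤ expPayoff p us σ tauStar ∧
      expPayoff p ur σ' tauStar ≤ expPayoff p ur σ tauStar) ∨
  (expPayoff p us σ tauStar ≤ expPayoff p us σ' tauStar ∧
      expPayoff p ur σ tauStar ≤ expPayoff p ur σ' tauStar)

/-- Pointwise convex combination of two experiments. -/
noncomputable def mixExp {Ω A : Type*} (lam : ℝ) (σ1 σ2 : Ω → A → ℝ) : Ω → A → ℝ :=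
  fun ω a => lam * σ1 ω a + (1 - lam) * σ2 ω a

/-- `(σbar, σlo, lam)` is a Pareto-ranked splitting of the experiment `σ`. -/
def ParetoRankedSplitting {Ω A : Type*} [Fintype Ω] [Fintype A] [DecidableEq A]
    (p : Ω → ℝ) (us ur : A → Ω → ℝ) (σbar σlo : Ω → A → ℝ) (lam : ℝ) (σ : Ω → A → ℝ) : Prop :=
  IsKernel σbar ∧ IsKernel σlo ∧ lam ∈ Set.Ioo (0 : ℝ) 1 ∧
    mixExp lam σbar σlo = σ ∧ ParetoRanked p us ur σbar σlo

/-- The `((σbar, σlo), lam)`-probability premium of a player with utility `u` and index `φ`. -/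
noncomputable def probPremium {Ω A : Type*} [Fintype Ω] [Fintype A] [DecidableEq A]
    (p : Ω → ℝ) (u : A → Ω → ℝ) (φ : ℝ → ℝ) (σbar σlo : Ω → A → ℝ) (lam : ℝ) : ℝ :=
  (φ (expPayoff p u (mixExp lam σbar σlo) tauStar) -
      lam * φ (expPayoff p u σbar tauStar) - (1 - lam) * φ (expPayoff p u σlo tauStar)) /
    (φ (expPayoff p u σbar tauStar) - φ (expPayoff p u σlo tauStar))

/-- The set of `φs`-transformed sender values attainable by obedient ambiguous experiments;
the value of the sender's problem `(P)` equals `u` iff `φs u` is the least upper bound of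
this set (since `φs` is continuous and strictly increasing). -/
def senderValues {Ω A : Type*} [Fintype Ω] [Fintype A] [DecidableEq A]
    (φs φr : ℝ → ℝ) (p : Ω → ℝ) (us ur : A → Ω → ℝ) : Set ℝ :=
  {x | ∃ (n : ℕ) (σ : Fin n → Ω → A → ℝ) (μ : Fin n → ℝ),
    (∀ j, IsKernel (σ j)) ∧ IsProb μ ∧ AmbObedient φr p ur σ μ ∧
    x = ∑ j, μ j * φs (expPayoff p us (σ j) tauStar)}

/-- The set of feasible values of the auxiliary program `(Φ*(u))`: sums
`∑_θ λ_θ Φ_u(σ_θ)` over splittings `(λ_θ, σ_θ)` of obedient experiments, where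
`Φ_u(σ) = (φs(u_s(σ,τ*)) − φs(u)) / φr'(u_r(σ,τ*))`. -/
def phiProgram {Ω A : Type*} [Fintype Ω] [Fintype A] [DecidableEq A]
    (φs φr : ℝ → ℝ) (p : Ω → ℝ) (us ur : A → Ω → ℝ) (u : ℝ) : Set ℝ :=
  {x | ∃ (n : ℕ) (σ : Fin n → Ω → A → ℝ) (lam : Fin n → ℝ),
    (∀ j, IsKernel (σ j)) ∧ IsProb lam ∧
    Obedient p ur (fun ω a => ∑ j, lam j * σ j ω a) ∧
    x = ∑ j, lam j * ((φs (expPayoff p us (σ j) tauStar) - φs u) /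
      deriv φr (expPayoff p ur (σ j) tauStar))}

lemma Antitone.continuous_of_ordConnected_range {f : ℝ → ℝ} (hf : Antitone f)
    (h : (Set.range f).OrdConnected) : Continuous f := by
  refine continuous_iff_continuousAt.2 fun x => tendsto_order.2 ⟨fun b hb => ?_, fun b hb => ?_⟩
  · by_cases hx : b < f (x + 1)
    · filter_upwards [Iio_mem_nhds (lt_add_one x)] with y hy using hx.trans_le (hf hy.le)
    · obtain ⟨m, hbm, hm⟩ := exists_between hb
      obtain ⟨c, rfl⟩ := h.out ⟨x + 1, rfl⟩ ⟨x, rfl⟩ ⟨(not_lt.1 hx).trans hbm.le, hm.le⟩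
      filter_upwards [Iio_mem_nhds (hf.reflect_lt hm)] with y hy using hbm.trans_le (hf hy.le)
  · by_cases hx : f (x - 1) < b
    · filter_upwards [Ioi_mem_nhds (sub_one_lt x)] with y hy using (hf hy.le).trans_lt hx
    · obtain ⟨m, hm, hbm⟩ := exists_between hb
      obtain ⟨c, rfl⟩ := h.out ⟨x, rfl⟩ ⟨x - 1, rfl⟩ ⟨hm.le, hbm.le.trans (not_lt.1 hx)⟩
      filter_upwards [Ioi_mem_nhds (hf.reflect_lt hm)] with y hy using (hf hy.le).trans_lt hbm

lemma ConcaveOn.continuous_deriv {f : ℝ → ℝ} (hc : ConcaveOn ℝ Set.univ f)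
    (hd : Differentiable ℝ f) : Continuous (deriv f) := by
  refine Antitone.continuous_of_ordConnected_range
    (antitoneOn_univ.1 (hc.antitoneOn_deriv fun x _ => hd x)) ?_
  rw [← Set.image_univ]
  exact Set.ordConnected_univ.image_deriv fun x _ => hd x

lemma ConcaveOn.le_add_deriv_mul_sub {f : ℝ → ℝ} (hc : ConcaveOn ℝ Set.univ f)
    (hd : Differentiable ℝ f) (x y : ℝ) : f y ≤ f x + deriv f x * (y - x) := by
  rcases lt_trichotomy x y with h | rfl | h
  · have := hc.slope_le_deriv trivial trivial h (hd x)
    rw [slope_def_field, div_le_iff₀ (sub_pos.2 h)] at this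
    linarith
  · simp
  · have := hc.deriv_le_slope trivial trivial h (hd x)
    rw [slope_def_field, le_div_iff₀ (sub_pos.2 h)] at this
    linarith

lemma IsCompact.convexHull_of_finiteDimensional {E : Type*} [NormedAddCommGroup E]
    [NormedSpace ℝ E] [FiniteDimensional ℝ E] {s : Set E} (hs : IsCompact s) :
    IsCompact (convexHull ℝ s) := by
  rcases s.eq_empty_or_nonempty with rfl | ⟨x₀, hx₀⟩
  · simp
  let N := Module.finrank ℝ E + 1
  have hK : IsCompact (stdSimplex ℝ (Fin N) ×ˢ Set.univ.pi fun _ : Fin N => s) :=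
    (isCompact_stdSimplex ℝ (Fin N)).prod (isCompact_univ_pi fun _ => hs)
  have hcont : Continuous fun q : (Fin N → ℝ) × (Fin N → E) => ∑ i, q.1 i • q.2 i := by fun_prop
  convert hK.image hcont using 1
  ext x
  refine ⟨fun hx => ?_, ?_⟩
  · obtain ⟨ι, _, z, w, hz, hind, hw, hw1, rfl⟩ := eq_pos_convex_span_of_mem_convexHull hx
    have hcard : Fintype.card ι ≤ Fintype.card (Fin N) := by
      rw [Fintype.card_fin]
      exact hind.card_le_finrank_succ.trans (Nat.succ_le_succ (Submodule.finrank_le _))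
    obtain ⟨e⟩ := Function.Embedding.nonempty_of_card_le hcard
    have hout : ∀ i ∉ Set.range e, Function.extend e w 0 i = 0 := fun i hi =>
      Function.extend_apply' _ _ _ hi
    refine ⟨(Function.extend e w 0, Function.extend e z fun _ => x₀), ⟨⟨fun i => ?_, ?_⟩, ?_⟩, ?_⟩
    · by_cases hi : ∃ j, e j = i
      · obtain ⟨j, rfl⟩ := hi
        simpa [e.injective.extend_apply] using (hw j).le
      · exact (hout i hi).ge
    · rw [← hw1]
      exact (Fintype.sum_of_injective e e.injective _ _ hout
        fun i => (e.injective.extend_apply _ _ _).symm).symm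
    · intro i _
      by_cases hi : ∃ j, e j = i
      · obtain ⟨j, rfl⟩ := hi
        simpa [e.injective.extend_apply] using hz ⟨j, rfl⟩
      · simpa [Function.extend_apply' _ _ _ hi] using hx₀
    · refine (Fintype.sum_of_injective e e.injective _ _ (fun i hi => ?_) fun i => ?_).symm
      · simp [hout i hi]
      · simp [e.injective.extend_apply]
  · rintro ⟨⟨w, z⟩, ⟨hw, hz⟩, rfl⟩
    exact mem_convexHull_of_exists_fintype w z hw.1 hw.2 (fun i => hz i trivial) rfl

/-- A maximal point above `x` of the convex hull of a graph is a convex combination of points of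
the graph whose base points are affinely independent. -/
lemma exists_affineIndependent_of_isGreatest_convexHull_graph {E : Type*} [AddCommGroup E]
    [Module ℝ E] {s : Set E} {F : E → ℝ} {x : E} {t : ℝ}
    (h : IsGreatest {t | (x, t) ∈ convexHull ℝ ((fun y => (y, F y)) '' s)} t) :
    ∃ (n : ℕ) (z : Fin n → E) (w : Fin n → ℝ), (∀ i, z i ∈ s) ∧ AffineIndependent ℝ z ∧
      (∀ i, 0 ≤ w i) ∧ ∑ i, w i = 1 ∧ ∑ i, w i • z i = x ∧ ∑ i, w i * F (z i) = t := by
  obtain ⟨ι, _, q, w, hq, hind, hw, hw1, hsum⟩ := eq_pos_convex_span_of_mem_convexHull h.1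
  choose z hz hzq using fun i => hq ⟨i, rfl⟩
  obtain rfl : (fun i => (z i, F (z i))) = q := funext hzq
  simp only [Prod.smul_mk, Prod.ext_iff, Prod.fst_sum, Prod.snd_sum, smul_eq_mul] at hsum
  have key : AffineIndependent ℝ z := by
    rw [affineIndependent_iff_of_fintype]
    intro g hg hgz
    rw [Finset.univ.weightedVSub_eq_linear_combination hg] at hgz
    have hF : ∑ i, g i * F (z i) = 0 := by
      have hev : ∀ᶠ ε : ℝ in nhds 0, ∀ i, 0 < w i + ε * g i := by
        refine Filter.eventually_all.2 fun i => ?_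
        have : Continuous fun ε : ℝ => w i + ε * g i := by fun_prop
        exact this.continuousAt.eventually_const_lt (by simpa using hw i)
      have hmax : IsLocalMax (fun ε : ℝ => ε * ∑ i, g i * F (z i)) 0 := by
        filter_upwards [hev] with ε hε
        have := h.2 (show t + ε * ∑ i, g i * F (z i) ∈ _ from
          mem_convexHull_of_exists_fintype (fun i => w i + ε * g i) (fun i => (z i, F (z i)))
            (fun i => (hε i).le) ?_ (fun i => ⟨_, hz i, rfl⟩) ?_)
        · simpa using this
        · simp [Finset.sum_add_distrib, ← Finset.mul_sum, hg, hw1]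
        · simp [Prod.ext_iff, Prod.fst_sum, Prod.snd_sum, add_smul, mul_smul,
            Finset.sum_add_distrib, ← Finset.smul_sum, ← Finset.mul_sum, hgz, hsum.1, hsum.2]
      simpa using hmax.hasDerivAt_eq_zero ((hasDerivAt_id (0 : ℝ)).mul_const _)
    exact fun i => hind.eq_zero_of_sum_eq_zero (s := Finset.univ) hg
      (by simp [Prod.ext_iff, Prod.fst_sum, Prod.snd_sum, hgz, hF]) i (Finset.mem_univ i)
  let e := (Fintype.equivFin ι).symm
  refine ⟨_, z ∘ e, w ∘ e, fun i => hz _, key.comp_embedding e.toEmbedding, fun i => (hw _).le,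
    ?_, ?_, ?_⟩
  · rw [← hw1]; exact e.sum_comp w
  · rw [← hsum.1]; exact e.sum_comp fun i => w i • z i
  · rw [← hsum.2]; exact e.sum_comp fun i => w i * F (z i)

/-- If two sets of reals correspond to each other via `x = v + D * y`, with factors `D` bounded and
bounded away from zero, then `v` is the supremum of one iff `0` is the supremum of the other. -/
lemma isLUB_iff_isLUB_zero {S P : Set ℝ} {v c C : ℝ} (hc : 0 < c) (hC : 0 < C)
    (hSP : ∀ x ∈ S, ∃ y ∈ P, ∃ D ∈ Set.Icc c C, x = v + D * y)
    (hPS : ∀ y ∈ P, ∃ x ∈ S, ∃ D ∈ Set.Icc c C, x = v + D * y) :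
    IsLUB S v ↔ IsLUB P 0 := by
  constructor
  · refine fun h => ⟨fun y hy => ?_, fun b hb => ?_⟩
    · obtain ⟨x, hx, D, hD, rfl⟩ := hPS y hy
      have := h.1 hx
      exact nonpos_of_mul_nonpos_right (by linarith) (hc.trans_le hD.1)
    · by_contra! hb0
      have : v ≤ v + c * b := h.2 fun x hx => by
        obtain ⟨y, hy, D, hD, rfl⟩ := hSP x hx
        have := hb hy
        nlinarith [hD.1]
      nlinarith
  · refine fun h => ⟨fun x hx => ?_, fun b hb => ?_⟩
    · obtain ⟨y, hy, D, hD, rfl⟩ := hSP x hx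
      have := h.1 hy
      nlinarith [hD.1]
    · by_contra! hbv
      have : 0 ≤ (b - v) / C := h.2 fun y hy => by
        obtain ⟨x, hx, D, hD, rfl⟩ := hPS y hy
        have hxb := hb hx
        have hy0 : y < 0 := by
          by_contra! hy0
          nlinarith [hD.1]
        rw [le_div_iff₀ hC]
        nlinarith [hD.2]
      exact (div_neg_of_neg_of_pos (sub_neg.2 hbv) hC).not_ge this

lemma expPayoff_sum {Ω M A Θ : Type*} [Fintype Ω] [Fintype M] [Fintype A] [Fintype Θ] (p : Ω → ℝ)
    (u : A → Ω → ℝ) (lam : Θ → ℝ) (σ : Θ → Ω → M → ℝ) (τ : M → A → ℝ) :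
    expPayoff p u (fun ω a => ∑ j, lam j * σ j ω a) τ = ∑ j, lam j * expPayoff p u (σ j) τ := by
  have h (ω : Ω) (m : M) (a : A) : p ω * (∑ j, lam j * σ j ω m) * τ m a * u a ω =
      ∑ j, lam j * (p ω * σ j ω m * τ m a * u a ω) := by
    simp only [Finset.mul_sum, Finset.sum_mul]
    exact Finset.sum_congr rfl fun j _ => by ring
  simp only [expPayoff, h]
  simp only [Finset.mul_sum]
  rw [Finset.sum_comm (s := (Finset.univ : Finset Θ))]
  refine Finset.sum_congr rfl fun ω _ => ?_
  rw [Finset.sum_comm (s := (Finset.univ : Finset Θ))]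
  exact Finset.sum_congr rfl fun m _ => Finset.sum_comm

lemma expPayoff_segment {Ω M A : Type*} [Fintype Ω] [Fintype M] [Fintype A] (p : Ω → ℝ)
    (u : A → Ω → ℝ) (σ : Ω → M → ℝ) (τ τ' : M → A → ℝ) (t : ℝ) :
    expPayoff p u σ (fun m a => τ m a + t * (τ' m a - τ m a)) =
      expPayoff p u σ τ + t * (expPayoff p u σ τ' - expPayoff p u σ τ) := by
  simp only [expPayoff, Finset.mul_sum, ← Finset.sum_sub_distrib, ← Finset.sum_add_distrib]
  refine Finset.sum_congr rfl fun ω _ => Finset.sum_congr rfl fun m _ =>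
    Finset.sum_congr rfl fun a _ => ?_
  ring

lemma continuous_expPayoff {Ω M A : Type*} [Fintype Ω] [Fintype M] [Fintype A] (p : Ω → ℝ)
    (u : A → Ω → ℝ) (τ : M → A → ℝ) :
    Continuous fun σ : Ω → M → ℝ => expPayoff p u σ τ := by
  unfold expPayoff
  fun_prop

lemma isCompact_setOf_isKernel {X Y : Type*} [Fintype Y] :
    IsCompact {k : X → Y → ℝ | IsKernel k} := by
  have h : {k : X → Y → ℝ | IsKernel k} = Set.univ.pi fun _ => stdSimplex ℝ Y := by
    ext k
    simp [IsKernel, stdSimplex, forall_and]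
  rw [h]
  exact isCompact_univ_pi fun _ => isCompact_stdSimplex ℝ Y

lemma isKernel_tauStar {A : Type*} [Fintype A] [DecidableEq A] :
    IsKernel (tauStar : A → A → ℝ) :=
  ⟨fun m a => by unfold tauStar; split_ifs <;> norm_num, fun m => by simp [tauStar]⟩

lemma isClosed_setOf_obedient {Ω A : Type*} [Fintype Ω] [Fintype A] [DecidableEq A] (p : Ω → ℝ)
    (ur : A → Ω → ℝ) : IsClosed {σ : Ω → A → ℝ | Obedient p ur σ} := by
  simp only [Obedient, Set.ofPred_forall]
  exact isClosed_iInter fun τ => isClosed_iInter fun _ =>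
    isClosed_le (continuous_expPayoff p ur τ) (continuous_expPayoff p ur tauStar)

lemma IsKernel.segment {X Y : Type*} [Fintype Y] {k k' : X → Y → ℝ} (hk : IsKernel k)
    (hk' : IsKernel k') {t : ℝ} (ht0 : 0 ≤ t) (ht1 : t ≤ 1) :
    IsKernel fun x y => k x y + t * (k' x y - k x y) := by
  refine ⟨fun x y => ?_, fun x => ?_⟩
  · nlinarith [hk.1 x y, hk'.1 x y]
  · simp [Finset.sum_add_distrib, ← Finset.mul_sum, hk.2 x, hk'.2 x]

/-- First-order characterization of obedience of an ambiguous experiment. -/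
lemma ambObedient_iff_deriv {Ω A Θ : Type*} [Fintype Ω] [Fintype A] [DecidableEq A] [Fintype Θ]
    {φr : ℝ → ℝ} (hφr : SmoothIndex φr) (p : Ω → ℝ) (ur : A → Ω → ℝ) (σ : Θ → Ω → A → ℝ)
    {μ : Θ → ℝ} (hμ : ∀ θ, 0 ≤ μ θ) :
    AmbObedient φr p ur σ μ ↔ ∀ τ : A → A → ℝ, IsKernel τ →
      ∑ θ, μ θ * (deriv φr (expPayoff p ur (σ θ) tauStar) *
        (expPayoff p ur (σ θ) τ - expPayoff p ur (σ θ) tauStar)) ≤ 0 := by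
  obtain ⟨-, hconc, hdiff⟩ := hφr
  refine ⟨fun h τ hτ => ?_, fun h τ hτ => ?_⟩
  · let x θ := expPayoff p ur (σ θ) tauStar
    let v θ := expPayoff p ur (σ θ) τ - x θ
    have hder : HasDerivAt (fun t : ℝ => ∑ θ, μ θ * φr (x θ + t * v θ))
        (∑ θ, μ θ * (deriv φr (x θ) * v θ)) 0 := by
      refine HasDerivAt.fun_sum fun θ _ => HasDerivAt.const_mul _ ?_
      have hlin : HasDerivAt (fun t : ℝ => x θ + t * v θ) (v θ) 0 := by
        simpa using ((hasDerivAt_id (0 : ℝ)).mul_const (v θ)).const_add (x θ)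
      refine HasDerivAt.comp (0 : ℝ) ?_ hlin
      simpa using (hdiff (x θ)).hasDerivAt
    refine le_of_tendsto hder.tendsto_slope_zero_right ?_
    filter_upwards [Ioo_mem_nhdsGT (zero_lt_one' ℝ)] with t ht
    have := h _ (isKernel_tauStar.segment hτ ht.1.le ht.2.le)
    simp only [expPayoff_segment] at this
    refine mul_nonpos_of_nonneg_of_nonpos (inv_nonneg.2 ht.1.le) ?_
    simpa [x, v] using this
  · rw [← sub_nonpos, ← Finset.sum_sub_distrib]
    refine (Finset.sum_le_sum fun θ _ => ?_).trans (h τ hτ)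
    rw [← mul_sub]
    have := hconc.le_add_deriv_mul_sub hdiff (expPayoff p ur (σ θ) tauStar)
      (expPayoff p ur (σ θ) τ)
    exact mul_le_mul_of_nonneg_left (by linarith) (hμ θ)

/-- An ambiguous experiment is obedient iff the experiment with weights proportional to
`μ θ * φr' (u_r (σ θ, τ*))` is. -/
lemma ambObedient_iff_obedient {Ω A Θ : Type*} [Fintype Ω] [Fintype A] [DecidableEq A] [Fintype Θ]
    {φr : ℝ → ℝ} (hφr : SmoothIndex φr) (p : Ω → ℝ) (ur : A → Ω → ℝ) (σ : Θ → Ω → A → ℝ)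
    {μ lam : Θ → ℝ} {D : ℝ} (hμ : ∀ θ, 0 ≤ μ θ) (hD : 0 < D)
    (h : ∀ θ, μ θ * deriv φr (expPayoff p ur (σ θ) tauStar) = D * lam θ) :
    AmbObedient φr p ur σ μ ↔ Obedient p ur (fun ω a => ∑ j, lam j * σ j ω a) := by
  rw [ambObedient_iff_deriv hφr p ur σ hμ]
  refine forall₂_congr fun τ _ => ?_
  simp only [← mul_assoc, h, expPayoff_sum]
  simp only [mul_assoc, ← Finset.mul_sum]
  rw [← sub_nonpos (b := ∑ j, lam j * expPayoff p ur (σ j) tauStar), ← Finset.sum_sub_distrib]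
  simp only [mul_sub]
  exact ⟨fun h => nonpos_of_mul_nonpos_right h hD, mul_nonpos_of_nonneg_of_nonpos hD.le⟩

lemma sum_mul_eq_add_mul_sum_div {Θ : Type*} [Fintype Θ] {μ lam d f : Θ → ℝ} {D v : ℝ}
    (hμ : ∑ θ, μ θ = 1) (hd : ∀ θ, 0 < d θ) (h : ∀ θ, μ θ * d θ = D * lam θ) :
    ∑ θ, μ θ * f θ = v + D * ∑ θ, lam θ * ((f θ - v) / d θ) := by
  have hterm (θ : Θ) : D * (lam θ * ((f θ - v) / d θ)) = μ θ * f θ - μ θ * v := by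
    rw [← mul_assoc, ← h, ← mul_sub]
    field_simp [(hd θ).ne']
  simp [Finset.mul_sum, hterm, ← Finset.sum_mul, hμ]

/-- Weights can be multiplied by `d` and renormalized; the normalization factor lies between the
bounds of `d`. -/
lemma IsProb.exists_reweight {Θ : Type*} [Fintype Θ] {μ d : Θ → ℝ} {c C : ℝ} (hμ : IsProb μ)
    (hc : 0 < c) (hd : ∀ θ, d θ ∈ Set.Icc c C) :
    ∃ lam : Θ → ℝ, IsProb lam ∧ ∃ D ∈ Set.Icc c C, ∀ θ, μ θ * d θ = D * lam θ := by
  have hD : ∑ θ, μ θ * d θ ∈ Set.Icc c C :=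
    (convex_Icc c C).sum_mem (fun θ _ => hμ.1 θ) hμ.2 fun θ _ => hd θ
  have hD0 := hc.trans_le hD.1
  refine ⟨fun θ => μ θ * d θ / ∑ θ, μ θ * d θ, ⟨fun θ => ?_, ?_⟩, _, hD, fun θ => ?_⟩
  · exact div_nonneg (mul_nonneg (hμ.1 θ) (hc.le.trans (hd θ).1)) hD0.le
  · rw [← Finset.sum_div, div_self hD0.ne']
  · rw [mul_div_cancel₀ _ hD0.ne']

/-- Inverse of `IsProb.exists_reweight`. -/
lemma IsProb.exists_reweight_inv {Θ : Type*} [Fintype Θ] {lam d : Θ → ℝ} {c C : ℝ}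
    (hlam : IsProb lam) (hc : 0 < c) (hC : 0 < C) (hd : ∀ θ, d θ ∈ Set.Icc c C) :
    ∃ μ : Θ → ℝ, IsProb μ ∧ ∃ D ∈ Set.Icc c C, ∀ θ, μ θ * d θ = D * lam θ := by
  have hd0 θ : 0 < d θ := hc.trans_le (hd θ).1
  obtain ⟨μ, hμ, D, hD, h⟩ := hlam.exists_reweight (d := fun θ => (d θ)⁻¹) (inv_pos.2 hC)
    fun θ => ⟨inv_anti₀ (hd0 θ) (hd θ).2, inv_anti₀ hc (hd θ).1⟩
  have hD0 : 0 < D := (inv_pos.2 hC).trans_le hD.1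
  refine ⟨μ, hμ, D⁻¹, ⟨le_inv_of_le_inv₀ hD0 hD.2, inv_le_of_inv_le₀ hC hD.1⟩, fun θ => ?_⟩
  have := h θ
  have := (hd0 θ).ne'
  field_simp at *
  linarith

lemma exists_deriv_bounds {Ω A : Type*} [Fintype Ω] [Fintype A] [DecidableEq A] {φr : ℝ → ℝ}
    (hφr : SmoothIndex φr) (hφr' : ∀ x, 0 < deriv φr x) (p : Ω → ℝ) (ur : A → Ω → ℝ) :
    ∃ c C : ℝ, 0 < c ∧ 0 < C ∧ ∀ σ : Ω → A → ℝ, IsKernel σ →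
      deriv φr (expPayoff p ur σ tauStar) ∈ Set.Icc c C := by
  rcases {σ : Ω → A → ℝ | IsKernel σ}.eq_empty_or_nonempty with h | h
  · exact ⟨1, 1, one_pos, one_pos, fun σ hσ => (h.subset hσ).elim⟩
  have hcont : Continuous fun σ : Ω → A → ℝ => deriv φr (expPayoff p ur σ tauStar) :=
    (hφr.2.1.continuous_deriv hφr.2.2).comp (continuous_expPayoff p ur tauStar)
  obtain ⟨σ₁, -, h₁⟩ := isCompact_setOf_isKernel.exists_isMinOn h hcont.continuousOn
  obtain ⟨σ₂, -, h₂⟩ := isCompact_setOf_isKernel.exists_isMaxOn h hcont.continuousOn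
  exact ⟨_, _, hφr' _, hφr' _, fun σ hσ => ⟨h₁ hσ, h₂ hσ⟩⟩

/-- Affinely independent experiments number at most `|Ω| * (|A| - 1) + 1`. -/
lemma AffineIndependent.card_le_of_isKernel {Ω A ι : Type*} [Fintype Ω] [Fintype A] [Nonempty A]
    [Fintype ι] {z : ι → Ω → A → ℝ} (hz : AffineIndependent ℝ z) (hk : ∀ i, IsKernel (z i)) :
    Fintype.card ι ≤ Fintype.card Ω * (Fintype.card A - 1) + 1 := by
  classical
  obtain ⟨a₀⟩ := ‹Nonempty A›
  have hind : AffineIndependent ℝ fun i (q : Ω × {a : A // a ≠ a₀}) => z i q.1 q.2 := by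
    rw [affineIndependent_iff_of_fintype]
    intro g hg hgz
    rw [Finset.univ.weightedVSub_eq_linear_combination hg] at hgz
    have hne (ω : Ω) (a : A) (ha : a ≠ a₀) : ∑ i, g i * z i ω a = 0 := by
      simpa using congrFun hgz (ω, ⟨a, ha⟩)
    refine fun i => hz.eq_zero_of_sum_eq_zero (s := Finset.univ) hg ?_ i (Finset.mem_univ i)
    ext ω a
    simp only [Finset.sum_apply, Pi.smul_apply, smul_eq_mul, Pi.zero_apply]
    by_cases ha : a = a₀
    · have hrow : ∑ b, ∑ i, g i * z i ω b = 0 := by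
        rw [Finset.sum_comm]
        simp only [← Finset.mul_sum, (hk _).2, mul_one, hg]
      rwa [Finset.sum_eq_single_of_mem a (Finset.mem_univ a)
        fun b _ hb => hne ω b (ha ▸ hb)] at hrow
    · exact hne ω a ha
  refine hind.card_le_finrank_succ.trans (Nat.succ_le_succ ((Submodule.finrank_le _).trans ?_))
  simp

lemma mem_phiProgram_iff {Ω A : Type*} [Fintype Ω] [Fintype A] [DecidableEq A]
    {φs φr : ℝ → ℝ} {p : Ω → ℝ} {us ur : A → Ω → ℝ} {u y : ℝ} :
    y ∈ phiProgram φs φr p us ur u ↔ ∃ σ, Obedient p ur σ ∧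
      (σ, y) ∈ convexHull ℝ ((fun σ => (σ, (φs (expPayoff p us σ tauStar) - φs u) /
        deriv φr (expPayoff p ur σ tauStar))) '' {σ : Ω → A → ℝ | IsKernel σ}) := by
  constructor
  · rintro ⟨n, σ, lam, hσ, hlam, hob, rfl⟩
    refine ⟨_, hob, mem_convexHull_of_exists_fintype lam _ hlam.1 hlam.2
      (fun j => ⟨σ j, hσ j, rfl⟩) ?_⟩
    ext <;> simp [Prod.fst_sum, Prod.snd_sum]
  · rintro ⟨σ, hob, h⟩
    obtain ⟨ι, _, lam, q, hlam, hlam1, hq, hsum⟩ := mem_convexHull_iff_exists_fintype.1 h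
    choose z hz hzq using hq
    obtain rfl := funext hzq
    let e := (Fintype.equivFin ι).symm
    rw [← e.sum_comp] at hlam1 hsum
    simp only [Prod.smul_mk, Prod.ext_iff, Prod.fst_sum, Prod.snd_sum, smul_eq_mul] at hsum
    refine ⟨_, z ∘ e, lam ∘ e, fun j => hz _, ⟨fun j => hlam _, hlam1⟩, ?_, hsum.2.symm⟩
    convert hob
    rw [← hsum.1]
    simp

lemma isClosed_phiProgram {Ω A : Type*} [Fintype Ω] [Fintype A] [DecidableEq A]
    {φs φr : ℝ → ℝ} (hφs : SmoothIndex φs) (hφr : SmoothIndex φr) (hφr' : ∀ x, 0 < deriv φr x)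
    (p : Ω → ℝ) (us ur : A → Ω → ℝ) (u : ℝ) : IsClosed (phiProgram φs φr p us ur u) := by
  have hcont : Continuous fun σ : Ω → A → ℝ => (φs (expPayoff p us σ tauStar) - φs u) /
      deriv φr (expPayoff p ur σ tauStar) :=
    ((hφs.2.2.continuous.comp (continuous_expPayoff p us tauStar)).sub continuous_const).div
      ((hφr.2.1.continuous_deriv hφr.2.2).comp (continuous_expPayoff p ur tauStar))
      fun σ => (hφr' _).ne'
  have hK := ((isCompact_setOf_isKernel (X := Ω) (Y := A)).image
    (continuous_id.prodMk hcont)).convexHull_of_finiteDimensional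
  convert ((hK.inter_right ((isClosed_setOf_obedient p ur).preimage continuous_fst)).image
    continuous_snd).isClosed
  ext y
  rw [mem_phiProgram_iff]
  simp [and_comm]

/-- Theorem 6, concavification-like characterization: the value of the
sender's problem `(P)` is `u` — i.e. `φs u` is the least upper bound of the
(`φs`-transformed) sender values of obedient ambiguous experiments — iff `0` is the least
upper bound of the auxiliary program `(Φ*(u))`.  Moreover, there is a solution of `(P)`
whose support has at most `|Ω|·(|A|−1) + 1` elements. -/
theorem concavification_characterization
    {Ω A : Type*} [Fintype Ω] [Fintype A] [DecidableEq A]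
    (p : Ω → ℝ) (hp : IsProb p) (us ur : A → Ω → ℝ)
    (φs φr : ℝ → ℝ) (hφs : SmoothIndex φs) (hφr : SmoothIndex φr)
    (hφr' : ∀ x, 0 < deriv φr x) :
    (∀ u : ℝ, IsLUB (senderValues φs φr p us ur) (φs u) ↔
      IsLUB (phiProgram φs φr p us ur u) 0) ∧
    (∀ u : ℝ, IsLUB (senderValues φs φr p us ur) (φs u) →
      ∃ (n : ℕ) (σ : Fin n → Ω → A → ℝ) (μ : Fin n → ℝ),
        (∀ j, IsKernel (σ j)) ∧ IsProb μ ∧ AmbObedient φr p ur σ μ ∧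
        ∑ j, μ j * φs (expPayoff p us (σ j) tauStar) = φs u ∧
        (Finset.univ.filter fun j => μ j ≠ 0).card ≤
          Fintype.card Ω * (Fintype.card A - 1) + 1) := by
  obtain ⟨c, C, hc, hC, hbd⟩ := exists_deriv_bounds hφr hφr' p ur
  have hlub (u : ℝ) : IsLUB (senderValues φs φr p us ur) (φs u) ↔
      IsLUB (phiProgram φs φr p us ur u) 0 := by
    refine isLUB_iff_isLUB_zero hc hC ?_ ?_
    · rintro _ ⟨n, σ, μ, hσ, hμ, hob, rfl⟩
      obtain ⟨lam, hlam, D, hD, h⟩ := hμ.exists_reweight hc fun j => hbd _ (hσ j)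
      exact ⟨_, ⟨n, σ, lam, hσ, hlam, (ambObedient_iff_obedient hφr p ur σ hμ.1
        (hc.trans_le hD.1) h).1 hob, rfl⟩, D, hD,
        sum_mul_eq_add_mul_sum_div hμ.2 (fun _ => hφr' _) h⟩
    · rintro _ ⟨n, σ, lam, hσ, hlam, hob, rfl⟩
      obtain ⟨μ, hμ, D, hD, h⟩ := hlam.exists_reweight_inv hc hC fun j => hbd _ (hσ j)
      exact ⟨_, ⟨n, σ, μ, hσ, hμ, (ambObedient_iff_obedient hφr p ur σ hμ.1
        (hc.trans_le hD.1) h).2 hob, rfl⟩, D, hD,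
        sum_mul_eq_add_mul_sum_div hμ.2 (fun _ => hφr' _) h⟩
  refine ⟨hlub, fun u hu => ?_⟩
  have hu0 := (hlub u).1 hu
  have hne : (phiProgram φs φr p us ur u).Nonempty := hu0.nonempty
  obtain ⟨σ₀, hob₀, h₀⟩ := mem_phiProgram_iff.1
    (hu0.mem_of_isClosed hne (isClosed_phiProgram hφs hφr hφr' p us ur u))
  obtain ⟨n, z, lam, hz, hind, hlam, hlam1, hsum, hval⟩ :=
    exists_affineIndependent_of_isGreatest_convexHull_graph
      ⟨h₀, fun t ht => hu0.1 (mem_phiProgram_iff.2 ⟨σ₀, hob₀, ht⟩)⟩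
  have hob : Obedient p ur (fun ω a => ∑ j, lam j * z j ω a) := by
    convert hob₀
    simp [← hsum]
  obtain ⟨μ, hμ, D, hD, h⟩ :=
    IsProb.exists_reweight_inv ⟨hlam, hlam1⟩ hc hC fun j => hbd _ (hz j)
  refine ⟨n, z, μ, hz, hμ, (ambObedient_iff_obedient hφr p ur z hμ.1
    (hc.trans_le hD.1) h).2 hob, ?_, ?_⟩
  · rw [sum_mul_eq_add_mul_sum_div hμ.2 (fun _ => hφr' _) h, hval, mul_zero, add_zero]
  · have : Nonempty A := by
      by_contra hA
      rw [not_nonempty_iff] at hA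
      have hn : Nonempty (Fin n) := by
        by_contra hn
        rw [not_nonempty_iff] at hn
        simp at hlam1
      have hΩ : Nonempty Ω := by
        by_contra hΩ
        rw [not_nonempty_iff] at hΩ
        simpa using hp.2
      simpa using (hz hn.some).2 hΩ.some
    exact (Finset.card_filter_le _ _).trans (hind.card_le_of_isKernel hz)
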